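/- Let d ≥ 2 be an integer, v > 0, and E ∈ ℝ. Let f, f₁, f₂ : (0,∞) → ℝ be continuous, with f continuously differentiable and monotone non-decreasing, and v f(r) ≤ E for all r > 0. Let R : (0,∞) → ℝ be continuously differentiable with R(r) ≥ 0 and R'(r) ≤ 0 for all r > 0, and R(r) → 0 as r → ∞. Set η(r) = ∫₀^r [f₂(t) − f₁(t)] t^{d−1} dt, and assume η(r) ≥ 0 for all r ≥ 0, that the integrals ∫₀^∞ (f₂ − f₁)(v f − E) R² r^{d−1} dr and ∫₀^∞ [v f'(r) R(r)² + 2(v f(r) − E) R(r) R'(r)] η(r) dr converge, and that (v f(r) − E) R(r)² η(r) → 0 as r → ∞ and as r → 0⁺. Then I = ∫₀^∞ [f₂(r) − f₁(r)] [v f(r) − E] R(r)² r^{d−1} dr ≤ 0. -/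

import Mathlib

open MeasureTheory Filter Set
open scoped Topology

/-- key integral inequality of the `d`-dimensional refined comparison
theorem: if `η(r) = ∫₀^r (f₂(t) − f₁(t)) t^{d−1} dt ≥ 0` for all `r ≥ 0`, then
`I = ∫₀^∞ (f₂ − f₁)(v f − E) R² r^{d−1} dr ≤ 0`. -/
theorem kleinGordon_refined_integral_ineq_radial
    (d : ℕ) (hd : 2 ≤ d) (v E : ℝ) (hv : 0 < v)
    (f f₁ f₂ R : ℝ → ℝ)
    (hf_cont : ContinuousOn f (Ioi 0))
    (hf₁_cont : ContinuousOn f₁ (Ioi 0))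
    (hf₂_cont : ContinuousOn f₂ (Ioi 0))
    (hf_diff : ∀ r > (0:ℝ), DifferentiableAt ℝ f r)
    (hf'_cont : ContinuousOn (deriv f) (Ioi 0))
    (hf_mono : MonotoneOn f (Ioi 0))
    (hfE : ∀ r > (0:ℝ), v * f r ≤ E)
    (hR_diff : ∀ r > (0:ℝ), DifferentiableAt ℝ R r)
    (hR'_cont : ContinuousOn (deriv R) (Ioi 0))
    (hR_nonneg : ∀ r > (0:ℝ), 0 ≤ R r)
    (hR'_nonpos : ∀ r > (0:ℝ), deriv R r ≤ 0)
    (hR_lim : Tendsto R atTop (𝓝 0))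
    (hη : ∀ r ≥ (0:ℝ), 0 ≤ ∫ t in (0:ℝ)..r, (f₂ t - f₁ t) * t ^ (d - 1))
    (hint1 : IntegrableOn
      (fun r => (f₂ r - f₁ r) * (v * f r - E) * R r ^ 2 * r ^ (d - 1)) (Ioi 0))
    (hint2 : IntegrableOn
      (fun r => (v * deriv f r * R r ^ 2 + 2 * (v * f r - E) * R r * deriv R r)
        * ∫ t in (0:ℝ)..r, (f₂ t - f₁ t) * t ^ (d - 1)) (Ioi 0))
    (hlim_top : Tendsto
      (fun r => (v * f r - E) * R r ^ 2 * ∫ t in (0:ℝ)..r, (f₂ t - f₁ t) * t ^ (d - 1))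
      atTop (𝓝 0))
    (hlim_zero : Tendsto
      (fun r => (v * f r - E) * R r ^ 2 * ∫ t in (0:ℝ)..r, (f₂ t - f₁ t) * t ^ (d - 1))
      (𝓝[>] 0) (𝓝 0)) :
    (∫ r in Ioi (0:ℝ), (f₂ r - f₁ r) * (v * f r - E) * R r ^ 2 * r ^ (d - 1)) ≤ 0 := by
  have hderiv : ∀ r > (0:ℝ), HasDerivAt (fun r => (v * f r - E) * R r ^ 2)
      (v * deriv f r * R r ^ 2 + 2 * (v * f r - E) * R r * deriv R r) r := by
    intro r hr
    have h1 := ((hf_diff r hr).hasDerivAt.const_mul v).sub_const E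
    have h2 := (hR_diff r hr).hasDerivAt.pow 2
    refine (h1.mul h2).congr_deriv ?_
    simp only [Pi.pow_apply]
    push_cast
    ring
  have hf'nonneg : ∀ r > (0:ℝ), 0 ≤ deriv f r := by
    intro r hr
    have h := hf_mono.derivWithin_nonneg (x := r)
    rwa [derivWithin_of_isOpen isOpen_Ioi hr] at h
  have hu'nonneg : ∀ r > (0:ℝ),
      0 ≤ v * deriv f r * R r ^ 2 + 2 * (v * f r - E) * R r * deriv R r := by
    intro r hr
    have h1 : 0 ≤ v * deriv f r * R r ^ 2 :=
      mul_nonneg (mul_nonneg hv.le (hf'nonneg r hr)) (sq_nonneg _)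
    have h2 : 0 ≤ (E - v * f r) * (R r * (- deriv R r)) :=
      mul_nonneg (by linarith [hfE r hr])
        (mul_nonneg (hR_nonneg r hr) (by linarith [hR'_nonpos r hr]))
    nlinarith
  have hunonpos : ∀ r > (0:ℝ), (v * f r - E) * R r ^ 2 ≤ 0 := fun r hr =>
    mul_nonpos_of_nonpos_of_nonneg (by linarith [hfE r hr]) (sq_nonneg _)
  have humono : MonotoneOn (fun r => (v * f r - E) * R r ^ 2) (Ioi 0) := by
    refine monotoneOn_of_deriv_nonneg (convex_Ioi 0)
      (fun r hr => (hderiv r hr).continuousAt.continuousWithinAt) ?_ ?_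
    · intro r hr
      rw [interior_Ioi] at hr
      exact (hderiv r hr).differentiableAt.differentiableWithinAt
    · intro r hr
      rw [interior_Ioi] at hr
      rw [(hderiv r hr).deriv]
      exact hu'nonneg r hr
  by_cases hz : ∀ r > (0:ℝ), (v * f r - E) * R r ^ 2 = 0
  · refine (setIntegral_eq_zero_of_forall_eq_zero ?_).le
    intro r hr
    have := hz r hr
    calc _ = (f₂ r - f₁ r) * r ^ (d - 1) * ((v * f r - E) * R r ^ 2) := by ring
      _ = 0 := by rw [this, mul_zero]
  push Not at hz
  obtain ⟨a, ha, hane⟩ := hz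
  have hapos : (v * f a - E) * R a ^ 2 < 0 := lt_of_le_of_ne (hunonpos a ha) hane
  have hgc : ContinuousOn (fun t => (f₂ t - f₁ t) * t ^ (d - 1)) (Ioi 0) :=
    (hf₂_cont.sub hf₁_cont).mul (continuous_pow _).continuousOn
  have hga : IntegrableOn (fun t => (f₂ t - f₁ t) * t ^ (d - 1)) (Ioc 0 a) := by
    have h1 : IntegrableOn
      (fun r => (f₂ r - f₁ r) * (v * f r - E) * R r ^ 2 * r ^ (d - 1)) (Ioc 0 a) :=
      hint1.mono_set Ioc_subset_Ioi_self
    refine Integrable.mono (h1.const_mul ((v * f a - E) * R a ^ 2)⁻¹)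
      ((hgc.mono Ioc_subset_Ioi_self).aestronglyMeasurable measurableSet_Ioc) ?_
    refine (ae_restrict_iff' measurableSet_Ioc).2 (Eventually.of_forall ?_)
    intro t ht
    have hle := humono (mem_Ioi.2 ht.1) (mem_Ioi.2 ha) ht.2
    simp only at hle
    have e : ((v * f a - E) * R a ^ 2)⁻¹ *
        ((f₂ t - f₁ t) * (v * f t - E) * R t ^ 2 * t ^ (d - 1))
        = (((v * f t - E) * R t ^ 2) / ((v * f a - E) * R a ^ 2)) *
          ((f₂ t - f₁ t) * t ^ (d - 1)) := by ring
    have h1 : 1 ≤ ((v * f t - E) * R t ^ 2) / ((v * f a - E) * R a ^ 2) := by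
      rw [le_div_iff_of_neg hapos]; linarith
    rw [e, norm_mul (((v * f t - E) * R t ^ 2) / ((v * f a - E) * R a ^ 2))]
    refine le_mul_of_one_le_left (norm_nonneg ((f₂ t - f₁ t) * t ^ (d - 1))) ?_
    exact h1.trans (le_abs_self _)
  have hgi : ∀ r > (0:ℝ), IntervalIntegrable
      (fun t => (f₂ t - f₁ t) * t ^ (d - 1)) volume 0 r := by
    intro r hr
    have h1 : IntervalIntegrable
      (fun t => (f₂ t - f₁ t) * t ^ (d - 1)) volume 0 a :=
      (intervalIntegrable_iff_integrableOn_Ioc_of_le (le_of_lt ha)).2 hga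
    refine h1.trans (ContinuousOn.intervalIntegrable (hgc.mono ?_))
    intro x hx
    exact lt_of_lt_of_le (lt_min ha hr) hx.1
  have hηd : ∀ r ∈ Ioi (0:ℝ), HasDerivAt
      (fun r => ∫ t in (0:ℝ)..r, (f₂ t - f₁ t) * t ^ (d - 1))
      ((f₂ r - f₁ r) * r ^ (d - 1)) r := by
    intro r hr
    exact intervalIntegral.integral_hasDerivAt_right (hgi r hr)
      (hgc.stronglyMeasurableAtFilter isOpen_Ioi r hr)
      (hgc.continuousAt (isOpen_Ioi.mem_nhds hr))
  have e1 : (fun r => (f₂ r - f₁ r) * (v * f r - E) * R r ^ 2 * r ^ (d - 1))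
      = fun r => ((v * f r - E) * R r ^ 2) * ((f₂ r - f₁ r) * r ^ (d - 1)) := by
    funext r; ring
  rw [e1] at hint1 ⊢
  have key := integral_Ioi_mul_deriv_eq_deriv_mul (fun r hr => hderiv r hr) hηd
    hint1 hint2 hlim_zero hlim_top
  rw [key]
  have : 0 ≤ ∫ r in Ioi (0:ℝ),
      (v * deriv f r * R r ^ 2 + 2 * (v * f r - E) * R r * deriv R r)
        * ∫ t in (0:ℝ)..r, (f₂ t - f₁ t) * t ^ (d - 1) :=
    setIntegral_nonneg measurableSet_Ioi fun r hr =>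
      mul_nonneg (hu'nonneg r hr) (hη r (le_of_lt hr))
  linarith
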